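/- For every nonempty 𝒱-poset P, Σ_{A∈𝒜(P)} 2^{s(A)} equals the number of cutsets of P, where 𝒜(P) is the set of all maximal antichains of P and s(A)=Σ_{a∈A}|P_a|. -/

import Mathlib

/-- The order relation of the disjoint union of two ordered sets. -/
def sumRel {α β : Type} (r : α → α → Prop) (s : β → β → Prop) :
    α ⊕ β → α ⊕ β → Prop
  | Sum.inl a, Sum.inl a' => r a a'
  | Sum.inr b, Sum.inr b' => s b b'
  | _, _ => False

/-- The order relation obtained from `r` by adding a new greatest element
(represented by `none`). -/
def addTopRel {α : Type} (r : α → α → Prop) : Option α → Option α → Prop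
  | _, none => True
  | none, some _ => False
  | some a, some b => r a b

/-- The order relation obtained from `r` by adding a new least element
(represented by `none`). -/
def addBotRel {α : Type} (r : α → α → Prop) : Option α → Option α → Prop
  | none, _ => True
  | some _, none => False
  | some a, some b => r a b

/-- The relations (on arbitrary carrier types) that arise from the empty order by
repeatedly taking disjoint unions and adding a new greatest or least element;
the class is closed under relabelling along bijections. -/
inductive IsVRel : (α : Type) → (α → α → Prop) → Prop
  | empty (α : Type) (r : α → α → Prop) (h : IsEmpty α) : IsVRel α r
  | union {α β : Type} {r : α → α → Prop} {s : β → β → Prop} :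
      IsVRel α r → IsVRel β s → IsVRel (α ⊕ β) (sumRel r s)
  | addTop {α : Type} {r : α → α → Prop} : IsVRel α r → IsVRel (Option α) (addTopRel r)
  | addBot {α : Type} {r : α → α → Prop} : IsVRel α r → IsVRel (Option α) (addBotRel r)
  | congr {α β : Type} {r : α → α → Prop} {s : β → β → Prop} (e : α ≃ β)
      (he : ∀ a b : α, r a b ↔ s (e a) (e b)) : IsVRel α r → IsVRel β s

/-- A partially ordered set is a `𝒱`-poset if it can be built from the empty poset
by repeatedly taking disjoint unions and adding new greatest or least elements. -/
def IsVPoset (α : Type) [PartialOrder α] : Prop :=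
  IsVRel α (· ≤ ·)

section Basic

variable {α : Type} [PartialOrder α]

/-- Two elements of a poset are incomparable. -/
def Incomp (u v : α) : Prop := ¬(u ≤ v ∨ v ≤ u)

/-- An element `x` of a poset is basic if (B1) there are no two incomparable
elements `u, v` with `x > u` and `x > v`; (B2) there are no two incomparable
elements `u, v` with `x < u` and `x < v`; and (B3) there is no `u < x` such that
every element `w ≠ u, x` satisfies `(u ≥ w ↔ x ≥ w)` and `(u ≤ w ↔ x ≤ w)`. -/
def IsBasic (x : α) : Prop :=
  (¬∃ u v : α, Incomp u v ∧ u < x ∧ v < x) ∧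
  (¬∃ u v : α, Incomp u v ∧ x < u ∧ x < v) ∧
  ¬∃ u : α, u < x ∧ ∀ w : α, w ≠ u → w ≠ x →
    ((w ≤ u ↔ w ≤ x) ∧ (u ≤ w ↔ x ≤ w))

end Basic

section Stmt17

variable {α : Type} [PartialOrder α]

/-- `s` is a maximal antichain of a poset: an antichain that is not a proper
subset of another antichain. -/
def IsMaxAntichainSet (s : Set α) : Prop :=
  IsAntichain (· ≤ ·) s ∧ ∀ t : Set α, IsAntichain (· ≤ ·) t → s ⊆ t → s = t

/-- A lower element: a non-basic element lying below some basic element. -/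
def IsLowerElt (a : α) : Prop := ¬IsBasic a ∧ ∃ b : α, IsBasic b ∧ a < b

/-- An upper element: a non-basic element lying above some basic element. -/
def IsUpperElt (a : α) : Prop := ¬IsBasic a ∧ ∃ b : α, IsBasic b ∧ b < a

/-- The set of basic elements comparable to `a`; an element is *associated* to a
set `B` of basic elements precisely when this set equals `B` (i.e. it is
comparable to all elements of `B` and incomparable to every other basic
element). -/
def basicAssoc (a : α) : Set α := {b : α | IsBasic b ∧ (a ≤ b ∨ b ≤ a)}

open Classical in
/-- The set `P_a`: empty for basic `a`; for a lower element `a`,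
`{b : a < b, no c incomparable to a has c < b}`; for an upper element `a`
associated to the set `B` of basic elements,
`{b : b < a, no c incomparable to a has b < c}` minus the lower elements
associated to `B`. -/
noncomputable def pSet (a : α) : Set α :=
  if IsBasic a then ∅
  else if IsLowerElt a then {b : α | a < b ∧ ¬∃ c : α, Incomp a c ∧ c < b}
  else if IsUpperElt a then
    {b : α | b < a ∧ ¬∃ c : α, Incomp a c ∧ b < c} \
      {l : α | IsLowerElt l ∧ basicAssoc l = basicAssoc a}
  else ∅

/-- A cutset: a set of elements meeting every maximal chain. -/
def IsCutset (s : Set α) : Prop :=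
  ∀ c : Set α, IsMaxChain (· ≤ ·) c → (s ∩ c).Nonempty

end Stmt17

section Relative

open Finset Classical

variable {α : Type} [PartialOrder α] {S T Q : Finset α} {a b x : α}

/-- Two elements of a poset are comparable. -/
def Comparable (u v : α) : Prop := u ≤ v ∨ v ≤ u

/-- `x` is a basic element of the induced subposet `S`. -/
def BasicIn (S : Finset α) (x : α) : Prop :=
  x ∈ S ∧ (∀ u ∈ S, ∀ v ∈ S, u < x → v < x → Comparable u v) ∧
  (∀ u ∈ S, ∀ v ∈ S, x < u → x < v → Comparable u v) ∧
  ∀ u ∈ S, u < x → ∃ w ∈ S, w ≠ u ∧ w ≠ x ∧ ¬((w ≤ u ↔ w ≤ x) ∧ (u ≤ w ↔ x ≤ w))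

/-- `x` is a lower element of the induced subposet `S`. -/
def LowerIn (S : Finset α) (x : α) : Prop := ¬BasicIn S x ∧ ∃ b, BasicIn S b ∧ x < b

/-- `x` is an upper element of the induced subposet `S`. -/
def UpperIn (S : Finset α) (x : α) : Prop := ¬BasicIn S x ∧ ∃ b, BasicIn S b ∧ b < x

/-- `a` and `b` are associated to the same set of basic elements of `S`. -/
def AssocEq (S : Finset α) (a b : α) : Prop :=
  ∀ x, BasicIn S x → (Comparable a x ↔ Comparable b x)

/-- `b` belongs to the set `P_a` computed in the induced subposet `P = S`. -/
def MemPSet (S : Finset α) (a b : α) : Prop :=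
  b ∈ S ∧ ¬BasicIn S a ∧
  ((LowerIn S a ∧ a < b ∧ ∀ c ∈ S, c < b → Comparable a c) ∨
   (¬LowerIn S a ∧ UpperIn S a ∧ (b < a ∧ ∀ c ∈ S, b < c → Comparable a c) ∧
      ¬(LowerIn S b ∧ AssocEq S b a)))

/-- The cardinality of `P_a` computed in the induced subposet `P = S`. -/
noncomputable def pCard (S : Finset α) (a : α) : ℕ := #{b ∈ S | MemPSet S a b}

/-- The maximal antichains of the induced subposet `S`. -/
noncomputable def maxAntichains (S : Finset α) : Finset (Finset α) :=
  {A ∈ S.powerset | (∀ x ∈ A, ∀ y ∈ A, Comparable x y → x = y) ∧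
    ∀ x ∈ S, ∃ y ∈ A, Comparable x y}

/-- `c` is a maximal chain of the induced subposet `S`. -/
def IsMaxChainIn (S c : Finset α) : Prop :=
  c ⊆ S ∧ (∀ x ∈ c, ∀ y ∈ c, Comparable x y) ∧
    ∀ x ∈ S, (∀ y ∈ c, Comparable x y) → x ∈ c

/-- The cutsets of the induced subposet `S`. -/
noncomputable def cutsets (S : Finset α) : Finset (Finset α) :=
  {s ∈ S.powerset | ∀ c, IsMaxChainIn S c → ∃ x ∈ s, x ∈ c}

/-- The weighted sum over the maximal antichains of the induced subposet `S`. -/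
noncomputable def antichainSum (S : Finset α) : ℕ :=
  ∑ A ∈ maxAntichains S, 2 ^ ∑ a ∈ A, pCard S a

section Component

variable (hT : T ⊆ S) (hS : ∀ x ∈ T, ∀ y ∈ S, Comparable x y → y ∈ T)
include hT hS

theorem basicIn_component (hx : x ∈ T) : BasicIn S x ↔ BasicIn T x := by
  unfold BasicIn
  have hl : ∀ u ∈ S, u < x → u ∈ T := fun u hu h => hS x hx u hu (Or.inr h.le)
  have hg : ∀ u ∈ S, x < u → u ∈ T := fun u hu h => hS x hx u hu (Or.inl h.le)
  constructor
  · rintro ⟨-, h1, h2, h3⟩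
    refine ⟨hx, fun u hu v hv => h1 u (hT hu) v (hT hv),
      fun u hu v hv => h2 u (hT hu) v (hT hv), fun u hu hux => ?_⟩
    obtain ⟨w, hw, h4, h5, h6⟩ := h3 u (hT hu) hux
    refine ⟨w, ?_, h4, h5, h6⟩
    by_contra hwT
    have h7 : ¬Comparable x w := fun h => hwT (hS x hx w hw h)
    have h8 : ¬Comparable u w := fun h => hwT (hS u hu w hw h)
    unfold Comparable at h7 h8
    tauto
  · rintro ⟨-, h1, h2, h3⟩
    refine ⟨hT hx, fun u hu v hv h h' => h1 u (hl u hu h) v (hl v hv h') h h',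
      fun u hu v hv h h' => h2 u (hg u hu h) v (hg v hv h') h h', fun u hu hux => ?_⟩
    obtain ⟨w, hw, h4⟩ := h3 u (hl u hu hux) hux
    exact ⟨w, hT hw, h4⟩

theorem lowerIn_component (hx : x ∈ T) : LowerIn S x ↔ LowerIn T x := by
  unfold LowerIn
  rw [basicIn_component hT hS hx]
  refine and_congr_right fun _ => exists_congr fun b => ?_
  refine and_congr_left fun hb => ⟨fun h => ?_, fun h => ?_⟩
  · exact (basicIn_component hT hS (hS x hx b h.1 (Or.inl hb.le))).1 h
  · exact (basicIn_component hT hS h.1).2 h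

theorem upperIn_component (hx : x ∈ T) : UpperIn S x ↔ UpperIn T x := by
  unfold UpperIn
  rw [basicIn_component hT hS hx]
  refine and_congr_right fun _ => exists_congr fun b => ?_
  refine and_congr_left fun hb => ⟨fun h => ?_, fun h => ?_⟩
  · exact (basicIn_component hT hS (hS x hx b h.1 (Or.inr hb.le))).1 h
  · exact (basicIn_component hT hS h.1).2 h

theorem assocEq_component (ha : a ∈ T) (hb : b ∈ T) : AssocEq S a b ↔ AssocEq T a b := by
  unfold AssocEq
  refine ⟨fun h x hx => h x ((basicIn_component hT hS hx.1).2 hx), fun h x hx => ?_⟩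
  by_cases hxT : x ∈ T
  · exact h x ((basicIn_component hT hS hxT).1 hx)
  · exact iff_of_false (fun h => hxT (hS a ha x hx.1 h)) (fun h => hxT (hS b hb x hx.1 h))

theorem memPSet_component (ha : a ∈ T) : MemPSet S a b ↔ MemPSet T a b := by
  have hb : b ∈ T → ((∀ c ∈ S, c < b → Comparable a c) ↔ ∀ c ∈ T, c < b → Comparable a c) :=
    fun hb => ⟨fun h c hc => h c (hT hc),
      fun h c hc hcb => h c (hS b hb c hc (Or.inr hcb.le)) hcb⟩
  have hb' : b ∈ T → ((∀ c ∈ S, b < c → Comparable a c) ↔ ∀ c ∈ T, b < c → Comparable a c) :=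
    fun hb => ⟨fun h c hc => h c (hT hc),
      fun h c hc hcb => h c (hS b hb c hc (Or.inl hcb.le)) hcb⟩
  have hbT : b ∈ S → b < a ∨ a < b → b ∈ T := fun hbS h =>
    hS a ha b hbS (h.elim (fun h => Or.inr h.le) fun h => Or.inl h.le)
  by_cases hbm : b ∈ T
  · unfold MemPSet
    rw [basicIn_component hT hS ha, lowerIn_component hT hS ha, upperIn_component hT hS ha,
      lowerIn_component hT hS hbm, assocEq_component hT hS hbm ha, hb hbm, hb' hbm]
    simp only [hbm, hT hbm]
  · unfold MemPSet
    tauto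

theorem pCard_component (ha : a ∈ T) : pCard S a = pCard T a := by
  unfold pCard
  congr 1
  ext b
  simp only [mem_filter, memPSet_component hT hS ha]
  exact and_congr_left fun h => iff_of_true (hT h.1) h.1

end Component

section Core

variable (hQ : Q ⊆ S) (hU : ∀ u ∈ S, u ∉ Q → (∀ x ∈ S, Comparable u x) ∧
    ((∀ x ∈ Q, u < x) ∨ ∀ x ∈ Q, x < u))
  (hB : ∀ x ∈ Q, ∃ y, BasicIn Q y ∧ ¬Comparable x y)
include hQ hU hB

theorem basicIn_core (hne : Q.Nonempty) : BasicIn S x ↔ BasicIn Q x := by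
  have hxQ : BasicIn S x → x ∈ Q := by
    rintro ⟨hx, h1, h2, -⟩
    by_contra hxQ
    obtain ⟨q, hq⟩ := hne
    obtain ⟨y, hy, hqy⟩ := hB q hq
    rcases (hU x hx hxQ).2 with h | h
    · exact hqy (h2 q (hQ hq) y (hQ hy.1) (h q hq) (h y hy.1))
    · exact hqy (h1 q (hQ hq) y (hQ hy.1) (h q hq) (h y hy.1))
  constructor
  · intro h
    have hx := hxQ h
    obtain ⟨-, h1, h2, h3⟩ := h
    refine ⟨hx, fun u hu v hv => h1 u (hQ hu) v (hQ hv),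
      fun u hu v hv => h2 u (hQ hu) v (hQ hv), fun u hu hux => ?_⟩
    obtain ⟨w, hw, h4, h5, h6⟩ := h3 u (hQ hu) hux
    refine ⟨w, ?_, h4, h5, h6⟩
    by_contra hwQ
    rcases (hU w hw hwQ).2 with h | h
    · exact h6 ⟨iff_of_true (h u hu).le (h x hx).le,
        iff_of_false (h u hu).not_ge (h x hx).not_ge⟩
    · exact h6 ⟨iff_of_false (h u hu).not_ge (h x hx).not_ge,
        iff_of_true (h u hu).le (h x hx).le⟩
  · rintro ⟨hx, h1, h2, h3⟩
    refine ⟨hQ hx, fun u hu v hv h h' => ?_, fun u hu v hv h h' => ?_, fun u hu hux => ?_⟩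
    · by_cases huQ : u ∈ Q
      · by_cases hvQ : v ∈ Q
        · exact h1 u huQ v hvQ h h'
        · exact ((hU v hv hvQ).1 u hu).symm
      · exact (hU u hu huQ).1 v hv
    · by_cases huQ : u ∈ Q
      · by_cases hvQ : v ∈ Q
        · exact h2 u huQ v hvQ h h'
        · exact ((hU v hv hvQ).1 u hu).symm
      · exact (hU u hu huQ).1 v hv
    · by_cases huQ : u ∈ Q
      · obtain ⟨w, hw, h4⟩ := h3 u huQ hux
        exact ⟨w, hQ hw, h4⟩
      · obtain ⟨y, hy, hxy⟩ := hB x hx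
        have huy : u < y := by
          rcases (hU u hu huQ).2 with h | h
          · exact h y hy.1
          · exact absurd (h x hx) hux.asymm
        refine ⟨y, hQ hy.1, huy.ne', fun h => hxy (Or.inl h.ge), fun h => hxy (Or.inl ?_)⟩
        exact h.2.1 huy.le

theorem lowerIn_core (hne : Q.Nonempty) : LowerIn S x ↔ LowerIn Q x := by
  simp only [LowerIn, basicIn_core hQ hU hB hne]

theorem upperIn_core (hne : Q.Nonempty) : UpperIn S x ↔ UpperIn Q x := by
  simp only [UpperIn, basicIn_core hQ hU hB hne]

theorem assocEq_core (hne : Q.Nonempty) : AssocEq S a b ↔ AssocEq Q a b := by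
  simp only [AssocEq, basicIn_core hQ hU hB hne]

theorem memPSet_core (ha : a ∈ Q) : MemPSet S a b ↔ MemPSet Q a b := by
  have hne : Q.Nonempty := ⟨a, ha⟩
  obtain ⟨y, hy, hay⟩ := hB a ha
  simp only [MemPSet, lowerIn_core hQ hU hB hne, upperIn_core hQ hU hB hne,
    assocEq_core hQ hU hB hne, basicIn_core hQ hU hB hne]
  constructor
  · rintro ⟨hb, h1, h2⟩
    have hbQ : b ∈ Q := by
      by_contra hbQ
      rcases h2 with h2 | h2 <;> rcases (hU b hb hbQ).2 with h | h
      · exact (h a ha).asymm h2.2.1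
      · exact hay (h2.2.2 y (hQ hy.1) (h y hy.1))
      · exact hay (h2.2.2.1.2 y (hQ hy.1) (h y hy.1))
      · exact (h a ha).asymm h2.2.2.1.1
    exact ⟨hbQ, h1, h2.imp (fun h => ⟨h.1, h.2.1, fun c hc => h.2.2 c (hQ hc)⟩)
      fun h => ⟨h.1, h.2.1, ⟨h.2.2.1.1, fun c hc => h.2.2.1.2 c (hQ hc)⟩, h.2.2.2⟩⟩
  · rintro ⟨hb, h1, h2⟩
    have key : ∀ c ∈ S, (c ∈ Q → Comparable a c) → Comparable a c := fun c hc h => by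
      by_cases hcQ : c ∈ Q
      · exact h hcQ
      · exact ((hU c hc hcQ).1 a (hQ ha)).symm
    exact ⟨hQ hb, h1, h2.imp
      (fun h => ⟨h.1, h.2.1, fun c hc hcb => key c hc fun hcQ => h.2.2 c hcQ hcb⟩)
      fun h => ⟨h.1, h.2.1, ⟨h.2.2.1.1,
        fun c hc hcb => key c hc fun hcQ => h.2.2.1.2 c hcQ hcb⟩, h.2.2.2⟩⟩

theorem pCard_core (ha : a ∈ Q) : pCard S a = pCard Q a := by
  unfold pCard
  congr 1
  ext b
  simp only [mem_filter, memPSet_core hQ hU hB ha]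
  exact and_congr_left fun h => iff_of_true (hQ h.1) h.1

/-- An element below the whole core has everything above it in its `P`-set. -/
theorem pCard_of_below (hne : Q.Nonempty) (ha : a ∈ S) (h : ∀ x ∈ Q, a < x) :
    pCard S a = #{b ∈ S | a < b} := by
  unfold pCard
  congr 1
  refine filter_congr fun b hb => ?_
  have haQ : a ∉ Q := fun h' => (h a h').false
  have hnb : ¬BasicIn S a := fun h' => haQ ((basicIn_core hQ hU hB hne).1 h').1
  have hl : LowerIn S a := by
    obtain ⟨q, hq⟩ := hne
    obtain ⟨y, hy, -⟩ := hB q hq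
    exact ⟨hnb, y, (basicIn_core hQ hU hB ⟨q, hq⟩).2 hy, h y hy.1⟩
  exact ⟨fun h' => h'.2.2.elim (fun h => h.2.1) fun h => absurd hl h.1,
    fun h' => ⟨hb, hnb, Or.inl ⟨hl, h', fun c hc _ => (hU a ha haQ).1 c hc⟩⟩⟩

/-- The `P`-set of an element above the whole core consists of the elements below it
that are not below the whole core. -/
theorem pCard_of_above (hne : Q.Nonempty) (ha : a ∈ S) (h : ∀ x ∈ Q, x < a) :
    pCard S a = #{b ∈ S | b < a ∧ ¬∀ x ∈ Q, b < x} := by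
  unfold pCard
  congr 1
  refine filter_congr fun b hb => ?_
  have haQ : a ∉ Q := fun h' => (h a h').false
  have hnb : ∀ x, x ∉ Q → ¬BasicIn S x :=
    fun x hx h' => hx ((basicIn_core hQ hU hB hne).1 h').1
  have hnl : ¬LowerIn S a := by
    rintro ⟨-, y, hy, hay⟩
    exact (h y ((basicIn_core hQ hU hB hne).1 hy).1).asymm hay
  have hu : UpperIn S a := by
    obtain ⟨q, hq⟩ := hne
    obtain ⟨y, hy, -⟩ := hB q hq
    exact ⟨hnb a haQ, y, (basicIn_core hQ hU hB ⟨q, hq⟩).2 hy, h y hy.1⟩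
  have hlb : (LowerIn S b ∧ AssocEq S b a) ↔ ∀ x ∈ Q, b < x := by
    constructor
    · rintro ⟨⟨-, y, hy, hby⟩, h2⟩
      by_cases hbQ : b ∈ Q
      · obtain ⟨z, hz, hbz⟩ := hB b hbQ
        exact absurd ((h2 z ((basicIn_core hQ hU hB hne).2 hz)).2 (Or.inr (h z hz.1).le)) hbz
      · exact (hU b hb hbQ).2.resolve_right
          fun h' => (h' y ((basicIn_core hQ hU hB hne).1 hy).1).asymm hby
    · intro hbl
      have hbQ : b ∉ Q := fun h' => (hbl b h').false
      obtain ⟨q, hq⟩ := hne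
      obtain ⟨y, hy, -⟩ := hB q hq
      refine ⟨⟨hnb b hbQ, y, (basicIn_core hQ hU hB ⟨q, hq⟩).2 hy, hbl y hy.1⟩, fun x hx => ?_⟩
      exact iff_of_true ((hU b hb hbQ).1 x hx.1) ((hU a ha haQ).1 x hx.1)
  rw [← hlb]
  exact ⟨fun h' => h'.2.2.elim (fun h => absurd h.1 hnl) fun h => ⟨h.2.2.1.1, h.2.2.2⟩,
    fun h' => ⟨hb, hnb a haQ,
      Or.inr ⟨hnl, hu, ⟨h'.1, fun c hc _ => (hU a ha haQ).1 c hc⟩, h'.2⟩⟩⟩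

end Core

theorem sum_eq_mul_of_union {β : Type*} {T T' : Finset β} (hd : Disjoint T T')
    {F F₁ F₂ : Finset (Finset β)}
    (hF : ∀ s, s ∈ F ↔ s ⊆ T ∪ T' ∧ s ∩ T ∈ F₁ ∧ s ∩ T' ∈ F₂)
    (h₁ : ∀ s ∈ F₁, s ⊆ T) (h₂ : ∀ s ∈ F₂, s ⊆ T') (g h : Finset β → ℕ) :
    ∑ s ∈ F, g (s ∩ T) * h (s ∩ T') = (∑ s ∈ F₁, g s) * ∑ s ∈ F₂, h s := by
  rw [sum_mul_sum, ← sum_product']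
  refine sum_nbij' (fun s => (s ∩ T, s ∩ T')) (fun p => p.1 ∪ p.2) ?_ ?_ ?_ ?_ ?_
  · intro s hs
    exact mem_product.2 ((hF s).1 hs).2
  · rintro ⟨s, t⟩ hst
    obtain ⟨hs, ht⟩ := mem_product.1 hst
    have hsT := h₁ s hs
    have htT := h₂ t ht
    have e₁ : (s ∪ t) ∩ T = s := by
      rw [union_inter_distrib_right, inter_eq_left.2 hsT,
        disjoint_iff_inter_eq_empty.1 (hd.symm.mono_left htT), union_empty]
    have e₂ : (s ∪ t) ∩ T' = t := by
      rw [union_inter_distrib_right, inter_eq_left.2 htT,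
        disjoint_iff_inter_eq_empty.1 (hd.mono_left hsT), empty_union]
    refine (hF _).2 ⟨union_subset_union hsT htT, ?_, ?_⟩
    · rwa [e₁]
    · rwa [e₂]
  · intro s hs
    simp only
    rw [← inter_union_distrib_left, inter_eq_left.2 ((hF s).1 hs).1]
  · rintro ⟨s, t⟩ hst
    obtain ⟨hs, ht⟩ := mem_product.1 hst
    have hsT := h₁ s hs
    have htT := h₂ t ht
    simp only [Prod.mk.injEq]
    constructor
    · rw [union_inter_distrib_right, inter_eq_left.2 hsT,
        disjoint_iff_inter_eq_empty.1 (hd.symm.mono_left htT), union_empty]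
    · rw [union_inter_distrib_right, inter_eq_left.2 htT,
        disjoint_iff_inter_eq_empty.1 (hd.mono_left hsT), empty_union]
  · intro s _
    rfl

theorem IsMaxChainIn.nonempty {c : Finset α} (hc : IsMaxChainIn S c) (hS : S.Nonempty) :
    c.Nonempty := by
  obtain ⟨x, hx⟩ := hS
  by_contra h
  rw [not_nonempty_iff_eq_empty] at h
  subst h
  exact notMem_empty x (hc.2.2 x hx (by simp))

theorem Comparable.symm {a b : α} (h : Comparable a b) : Comparable b a := Or.symm h

theorem comparable_refl (a : α) : Comparable a a := Or.inl le_rfl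

section Union

variable {T' : Finset α} (hn : ∀ x ∈ T, ∀ y ∈ T', ¬Comparable x y)
include hn

theorem disjoint_of_not_comparable : Disjoint T T' :=
  disjoint_left.2 fun x hx hx' => hn x hx x hx' (comparable_refl x)

theorem isMaxChainIn_union_of_left {c : Finset α} (hT : T.Nonempty) (hc : IsMaxChainIn T c) :
    IsMaxChainIn (T ∪ T') c := by
  refine ⟨hc.1.trans subset_union_left, hc.2.1, fun x hx h => ?_⟩
  rcases mem_union.1 hx with hx | hx
  · exact hc.2.2 x hx h
  · obtain ⟨y, hy⟩ := hc.nonempty hT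
    exact absurd (h y hy).symm (hn y (hc.1 hy) x hx)

theorem isMaxChainIn_left_of_union {c : Finset α} (hc : IsMaxChainIn (T ∪ T') c)
    (hx : x ∈ c) (hxT : x ∈ T) : IsMaxChainIn T c := by
  refine ⟨fun y hy => ?_, hc.2.1, fun y hy => hc.2.2 y (mem_union_left _ hy)⟩
  exact (mem_union.1 (hc.1 hy)).resolve_right fun h => hn x hxT y h (hc.2.1 x hx y hy)

theorem mem_cutsets_union (hT : T.Nonempty) (hT' : T'.Nonempty) (s : Finset α) :
    s ∈ cutsets (T ∪ T') ↔ s ⊆ T ∪ T' ∧ s ∩ T ∈ cutsets T ∧ s ∩ T' ∈ cutsets T' := by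
  have hn' : ∀ x ∈ T', ∀ y ∈ T, ¬Comparable x y := fun x hx y hy h => hn y hy x hx h.symm
  simp only [cutsets, mem_filter, mem_powerset, inter_subset_right, true_and, mem_inter]
  refine and_congr_right fun hs => ⟨fun h => ⟨fun c hc => ?_, fun c hc => ?_⟩, fun h c hc => ?_⟩
  · obtain ⟨x, hx, hxc⟩ := h c (isMaxChainIn_union_of_left hn hT hc)
    exact ⟨x, ⟨hx, hc.1 hxc⟩, hxc⟩
  · obtain ⟨x, hx, hxc⟩ := h c (by
      rw [union_comm]; exact isMaxChainIn_union_of_left hn' hT' hc)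
    exact ⟨x, ⟨hx, hc.1 hxc⟩, hxc⟩
  · obtain ⟨x, hx⟩ := hc.nonempty (hT.mono subset_union_left)
    rcases mem_union.1 (hc.1 hx) with hxT | hxT
    · obtain ⟨y, hy, hyc⟩ := h.1 c (isMaxChainIn_left_of_union hn hc hx hxT)
      exact ⟨y, hy.1, hyc⟩
    · obtain ⟨y, hy, hyc⟩ := h.2 c
        (isMaxChainIn_left_of_union hn' (by rwa [union_comm]) hx hxT)
      exact ⟨y, hy.1, hyc⟩

theorem card_cutsets_union (hT : T.Nonempty) (hT' : T'.Nonempty) :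
    #(cutsets (T ∪ T')) = #(cutsets T) * #(cutsets T') := by
  have := sum_eq_mul_of_union (disjoint_of_not_comparable hn) (mem_cutsets_union hn hT hT')
    (fun s hs => mem_powerset.1 (mem_filter.1 hs).1)
    (fun s hs => mem_powerset.1 (mem_filter.1 hs).1) (fun _ => 1) (fun _ => 1)
  simpa using this

theorem mem_maxAntichains_union (s : Finset α) :
    s ∈ maxAntichains (T ∪ T') ↔
      s ⊆ T ∪ T' ∧ s ∩ T ∈ maxAntichains T ∧ s ∩ T' ∈ maxAntichains T' := by
  simp only [maxAntichains, mem_filter, mem_powerset, inter_subset_right, true_and, mem_inter]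
  refine and_congr_right fun hs => ⟨fun h => ⟨⟨?_, ?_⟩, ?_, ?_⟩, fun h => ⟨?_, ?_⟩⟩
  · exact fun x hx y hy => h.1 x hx.1 y hy.1
  · intro x hx
    obtain ⟨y, hy, hxy⟩ := h.2 x (mem_union_left _ hx)
    exact ⟨y, ⟨hy, (mem_union.1 (hs hy)).resolve_right fun h => hn x hx y h hxy⟩, hxy⟩
  · exact fun x hx y hy => h.1 x hx.1 y hy.1
  · intro x hx
    obtain ⟨y, hy, hxy⟩ := h.2 x (mem_union_right _ hx)
    exact ⟨y, ⟨hy, (mem_union.1 (hs hy)).resolve_left fun h => hn y h x hx hxy.symm⟩, hxy⟩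
  · intro x hx y hy hxy
    rcases mem_union.1 (hs hx) with hxT | hxT <;> rcases mem_union.1 (hs hy) with hyT | hyT
    · exact h.1.1 x ⟨hx, hxT⟩ y ⟨hy, hyT⟩ hxy
    · exact absurd hxy (hn x hxT y hyT)
    · exact absurd hxy.symm (hn y hyT x hxT)
    · exact h.2.1 x ⟨hx, hxT⟩ y ⟨hy, hyT⟩ hxy
  · intro x hx
    rcases mem_union.1 hx with hxT | hxT
    · obtain ⟨y, hy, hxy⟩ := h.1.2 x hxT
      exact ⟨y, hy.1, hxy⟩
    · obtain ⟨y, hy, hxy⟩ := h.2.2 x hxT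
      exact ⟨y, hy.1, hxy⟩

theorem mem_left_of_comparable (y : α) (hx : x ∈ T) (hy : y ∈ T ∪ T') (h : Comparable x y) :
    y ∈ T :=
  (mem_union.1 hy).resolve_right fun h' => hn x hx y h' h

theorem mem_right_of_comparable (y : α) (hx : x ∈ T') (hy : y ∈ T ∪ T') (h : Comparable x y) :
    y ∈ T' :=
  (mem_union.1 hy).resolve_left fun h' => hn y h' x hx h.symm

theorem antichainSum_union :
    antichainSum (T ∪ T') = antichainSum T * antichainSum T' := by
  have hd := disjoint_of_not_comparable hn
  unfold antichainSum
  rw [← sum_eq_mul_of_union hd (mem_maxAntichains_union hn)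
    (fun s hs => mem_powerset.1 (mem_filter.1 hs).1)
    (fun s hs => mem_powerset.1 (mem_filter.1 hs).1)]
  refine sum_congr rfl fun A hA => ?_
  have hA' : A = (A ∩ T) ∪ (A ∩ T') := by
    rw [← inter_union_distrib_left, inter_eq_left.2 (mem_powerset.1 (mem_filter.1 hA).1)]
  rw [← pow_add]
  congr 1
  conv_lhs => rw [hA']
  rw [sum_union (hd.mono inter_subset_right inter_subset_right)]
  congr 1
  · refine sum_congr rfl fun a ha => pCard_component subset_union_left ?_ (mem_inter.1 ha).2
    exact fun x hx y hy => mem_left_of_comparable hn y hx hy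
  · refine sum_congr rfl fun a ha => pCard_component subset_union_right ?_ (mem_inter.1 ha).2
    exact fun x hx y hy => mem_right_of_comparable hn y hx hy

end Union

section Universal

variable (hQ : Q ⊆ S) (hU : ∀ u ∈ S, u ∉ Q → ∀ x ∈ S, Comparable u x)
include hQ hU

theorem mem_maxAntichains_iff (hS : S.Nonempty) (A : Finset α) :
    A ∈ maxAntichains S ↔
      A ∈ (S \ Q).image (fun u => {u}) ∪ {A ∈ maxAntichains Q | A.Nonempty} := by
  simp only [maxAntichains, mem_filter, mem_powerset, mem_union, mem_image, mem_sdiff]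
  constructor
  · rintro ⟨hA, h1, h2⟩
    by_cases hAQ : A ⊆ Q
    · refine Or.inr ⟨⟨hAQ, h1, fun x hx => h2 x (hQ hx)⟩, ?_⟩
      obtain ⟨x, hx⟩ := hS
      obtain ⟨y, hy, -⟩ := h2 x hx
      exact ⟨y, hy⟩
    · obtain ⟨u, hu, huQ⟩ := not_subset.1 hAQ
      refine Or.inl ⟨u, ⟨hA hu, huQ⟩, ?_⟩
      ext x
      rw [mem_singleton]
      exact ⟨fun h => h ▸ hu, fun h => (h1 u hu x h (hU u (hA hu) huQ x (hA h))).symm⟩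
  · rintro (⟨u, hu, rfl⟩ | ⟨⟨hA, h1, h2⟩, y, hy⟩)
    · refine ⟨singleton_subset_iff.2 hu.1, by simp, fun x hx => ?_⟩
      exact ⟨u, mem_singleton_self u, (hU u hu.1 hu.2 x hx).symm⟩
    · refine ⟨hA.trans hQ, h1, fun x hx => ?_⟩
      by_cases hxQ : x ∈ Q
      · exact h2 x hxQ
      · exact ⟨y, hy, hU x hx hxQ y (hQ (hA hy))⟩

theorem antichainSum_eq (hS : S.Nonempty) :
    antichainSum S = ∑ u ∈ S \ Q, 2 ^ pCard S u +
      ∑ A ∈ maxAntichains Q with A.Nonempty, 2 ^ ∑ a ∈ A, pCard S a := by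
  unfold antichainSum
  rw [Finset.ext (mem_maxAntichains_iff hQ hU hS), sum_union, sum_image]
  · simp
  · exact fun x _ y _ h => singleton_injective h
  · rw [disjoint_left]
    intro A hA hA'
    obtain ⟨u, hu, rfl⟩ := mem_image.1 hA
    rw [mem_filter, maxAntichains, mem_filter, mem_powerset, singleton_subset_iff] at hA'
    exact (mem_sdiff.1 hu).2 hA'.1.1

theorem mem_noncutsets_iff (s : Finset α) :
    s ∈ S.powerset \ cutsets S ↔ s ∈ Q.powerset \ cutsets Q := by
  simp only [cutsets, mem_sdiff, mem_filter, mem_powerset, not_and, not_forall, not_exists]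
  constructor
  · rintro ⟨hs, h⟩
    obtain ⟨c, hc, h⟩ := h hs
    have hUc : ∀ u ∈ S, u ∉ Q → u ∈ c :=
      fun u hu huQ => hc.2.2 u hu fun y hy => hU u hu huQ y (hc.1 hy)
    refine ⟨fun x hx => by_contra fun hxQ => h x hx (hUc x (hs hx) hxQ), fun _ => ?_⟩
    refine ⟨c ∩ Q, ⟨inter_subset_right, fun x hx y hy => ?_, fun x hx hxc => ?_⟩,
      fun x hx hxc => h x hx (mem_inter.1 hxc).1⟩
    · exact hc.2.1 x (mem_inter.1 hx).1 y (mem_inter.1 hy).1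
    · refine mem_inter.2 ⟨hc.2.2 x (hQ hx) fun y hy => ?_, hx⟩
      by_cases hyQ : y ∈ Q
      · exact hxc y (mem_inter.2 ⟨hy, hyQ⟩)
      · exact (hU y (hc.1 hy) hyQ x (hQ hx)).symm
  · rintro ⟨hs, h⟩
    obtain ⟨c, hc, h⟩ := h hs
    refine ⟨hs.trans hQ, fun _ => ⟨c ∪ (S \ Q),
      ⟨union_subset (hc.1.trans hQ) sdiff_subset, fun x hx y hy => ?_, fun x hx hxc => ?_⟩,
      fun x hx hxc => ?_⟩⟩
    · have hmem : ∀ z ∈ c ∪ (S \ Q), z ∈ S :=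
        fun z hz => union_subset (hc.1.trans hQ) sdiff_subset hz
      rcases mem_union.1 hx with hx' | hx' <;> rcases mem_union.1 hy with hy' | hy'
      · exact hc.2.1 x hx' y hy'
      · exact (hU y (mem_sdiff.1 hy').1 (mem_sdiff.1 hy').2 x (hmem x hx)).symm
      all_goals exact hU x (mem_sdiff.1 hx').1 (mem_sdiff.1 hx').2 y (hmem y hy)
    · by_cases hxQ : x ∈ Q
      · exact mem_union_left _ (hc.2.2 x hxQ fun y hy => hxc y (mem_union_left _ hy))
      · exact mem_union_right _ (mem_sdiff.2 ⟨hx, hxQ⟩)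
    · rcases mem_union.1 hxc with hxc | hxc
      · exact h x hx hxc
      · exact (mem_sdiff.1 hxc).2 (hs hx)

theorem two_pow_add_card_cutsets :
    2 ^ #Q + #(cutsets S) = 2 ^ #S + #(cutsets Q) := by
  have hsub : ∀ R : Finset α, #(R.powerset \ cutsets R) + #(cutsets R) = 2 ^ #R := fun R => by
    rw [card_sdiff_add_card_eq_card (show cutsets R ⊆ R.powerset from filter_subset _ _),
      card_powerset]
  have h1 := hsub S
  have h2 := hsub Q
  rw [Finset.ext (mem_noncutsets_iff hQ hU)] at h1
  omega

end Universal

theorem sum_two_pow_card_lt (q : ℕ) (U : Finset α)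
    (hU : ∀ x ∈ U, ∀ y ∈ U, Comparable x y) :
    ∑ u ∈ U, 2 ^ (q + #{b ∈ U | b < u}) + 2 ^ q = 2 ^ (q + #U) := by
  induction hk : #U generalizing U with
  | zero => simp [card_eq_zero.1 hk]
  | succ k ih =>
    have hne : U.Nonempty := card_pos.1 (by omega)
    obtain ⟨m, hm⟩ := U.exists_maximal hne
    have hlt : ∀ x ∈ U.erase m, x < m := fun x hx => by
      obtain ⟨hxm, hx⟩ := mem_erase.1 hx
      rcases hU x hx m hm.1 with h | h
      · exact lt_of_le_of_ne h hxm
      · exact lt_of_le_of_ne (hm.2 hx h) hxm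
    have hcard : #(U.erase m) = k := by rw [card_erase_of_mem hm.1, hk]; rfl
    have ih' := ih (U.erase m)
      (fun x hx y hy => hU x (mem_of_mem_erase hx) y (mem_of_mem_erase hy)) hcard
    have hfm : ({b ∈ U | b < m} : Finset α) = U.erase m := by
      ext b
      simp only [mem_filter]
      exact ⟨fun h => mem_erase.2 ⟨h.2.ne, h.1⟩, fun h => ⟨mem_of_mem_erase h, hlt b h⟩⟩
    have hfu : ∀ u ∈ U.erase m,
        ({b ∈ U | b < u} : Finset α) = {b ∈ U.erase m | b < u} := fun u hu => by
      ext b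
      simp only [mem_filter, mem_erase]
      exact ⟨fun h => ⟨⟨(h.2.trans (hlt u hu)).ne, h.1⟩, h.2⟩, fun h => ⟨h.1.2, h.2⟩⟩
    rw [← add_sum_erase U _ hm.1, hfm, hcard,
      sum_congr rfl fun u hu => by rw [hfu u hu], add_assoc, ih', ← add_assoc, pow_succ]
    ring

theorem sum_two_pow_card_gt (q : ℕ) (U : Finset α)
    (hU : ∀ x ∈ U, ∀ y ∈ U, Comparable x y) :
    ∑ u ∈ U, 2 ^ (q + #{b ∈ U | u < b}) + 2 ^ q = 2 ^ (q + #U) :=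
  sum_two_pow_card_lt (α := αᵒᵈ) q U fun x hx y hy => (hU x hx y hy).symm

section CoreSum

variable (hQ : Q ⊆ S) (hU : ∀ u ∈ S, u ∉ Q → (∀ x ∈ S, Comparable u x) ∧
    ((∀ x ∈ Q, u < x) ∨ ∀ x ∈ Q, x < u))
  (hB : ∀ x ∈ Q, ∃ y, BasicIn Q y ∧ ¬Comparable x y)
include hQ hU hB

theorem sum_two_pow_pCard_core (hne : Q.Nonempty) :
    ∑ u ∈ S \ Q, 2 ^ pCard S u + 2 ^ #Q = 2 ^ #S := by
  set L : Finset α := {u ∈ S \ Q | ∀ x ∈ Q, u < x} with hL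
  set V : Finset α := {u ∈ S \ Q | ¬∀ x ∈ Q, u < x} with hV
  have mL : ∀ u, u ∈ L ↔ (u ∈ S ∧ u ∉ Q) ∧ ∀ x ∈ Q, u < x := fun u => by
    rw [hL, mem_filter, mem_sdiff]
  have mV : ∀ u, u ∈ V ↔ (u ∈ S ∧ u ∉ Q) ∧ ¬∀ x ∈ Q, u < x := fun u => by
    rw [hV, mem_filter, mem_sdiff]
  have hVa : ∀ u ∈ V, ∀ x ∈ Q, x < u := fun u hu =>
    (hU u ((mV u).1 hu).1.1 ((mV u).1 hu).1.2).2.resolve_left ((mV u).1 hu).2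
  have hQV : Disjoint Q V := disjoint_left.2 fun x hx hx' => ((mV x).1 hx').1.2 hx
  have hQVL : Disjoint (Q ∪ V) L := by
    rw [disjoint_left]
    intro x hx hx'
    rcases mem_union.1 hx with hx | hx
    · exact ((mL x).1 hx').1.2 hx
    · exact ((mV x).1 hx).2 ((mL x).1 hx').2
  have hcard : #S = #Q + #V + #L := by
    rw [← card_union_of_disjoint hQV, ← card_union_of_disjoint hQVL]
    congr 1
    ext x
    simp only [mem_union, mL, mV]
    have := @hQ x
    tauto
  have hpV : ∀ u ∈ V, pCard S u = #Q + #{b ∈ V | b < u} := fun u hu => by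
    rw [pCard_of_above hQ hU hB hne ((mV u).1 hu).1.1 (hVa u hu),
      ← card_union_of_disjoint (hQV.mono_right (filter_subset _ _))]
    congr 1
    ext b
    simp only [mem_filter, mem_union, mV]
    constructor
    · rintro ⟨hb, hbu, hn⟩
      by_cases hbQ : b ∈ Q
      · exact Or.inl hbQ
      · exact Or.inr ⟨⟨⟨hb, hbQ⟩, hn⟩, hbu⟩
    · rintro (hb | hb)
      · exact ⟨hQ hb, hVa u hu b hb, fun h => (h b hb).false⟩
      · exact ⟨hb.1.1.1, hb.2, hb.1.2⟩
  have hpL : ∀ u ∈ L, pCard S u = #Q + #V + #{b ∈ L | u < b} := fun u hu => by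
    have huQ := ((mL u).1 hu).2
    rw [pCard_of_below hQ hU hB hne ((mL u).1 hu).1.1 huQ,
      ← card_union_of_disjoint hQV,
      ← card_union_of_disjoint (hQVL.mono_right (filter_subset _ _))]
    congr 1
    ext b
    simp only [mem_filter, mem_union]
    constructor
    · rintro ⟨hb, hub⟩
      rw [mV, mL]
      tauto
    · rintro ((hb | hb) | hb)
      · exact ⟨hQ hb, huQ b hb⟩
      · obtain ⟨q, hq⟩ := hne
        exact ⟨((mV b).1 hb).1.1, (huQ q hq).trans (hVa b hb q hq)⟩
      · exact ⟨((mL b).1 hb.1).1.1, hb.2⟩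
  have hc : ∀ x ∈ S \ Q, ∀ y ∈ S \ Q, Comparable x y := fun x hx y hy =>
    (hU x (mem_sdiff.1 hx).1 (mem_sdiff.1 hx).2).1 y (mem_sdiff.1 hy).1
  have hsV := sum_two_pow_card_lt #Q V fun x hx y hy =>
    hc x (filter_subset _ _ hx) y (filter_subset _ _ hy)
  have hsL := sum_two_pow_card_gt (#Q + #V) L fun x hx y hy =>
    hc x (filter_subset _ _ hx) y (filter_subset _ _ hy)
  rw [← sum_filter_add_sum_filter_not (S \ Q) (fun u => ∀ x ∈ Q, u < x), ← hL, ← hV,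
    sum_congr rfl fun u hu => by rw [hpL u hu], sum_congr (s₁ := V) rfl fun u hu => by rw [hpV u hu],
    hcard]
  omega

theorem antichainSum_eq_card_cutsets_of_core (hne : Q.Nonempty)
    (h : antichainSum Q = #(cutsets Q)) : antichainSum S = #(cutsets S) := by
  have hU' : ∀ u ∈ S, u ∉ Q → ∀ x ∈ S, Comparable u x := fun u hu huQ => (hU u hu huQ).1
  have hs : ∑ A ∈ maxAntichains Q with A.Nonempty, 2 ^ ∑ a ∈ A, pCard S a = antichainSum Q := by
    rw [filter_true_of_mem fun A hA => ?_, antichainSum]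
    · refine sum_congr rfl fun A hA => ?_
      rw [sum_congr rfl fun a ha =>
        pCard_core hQ hU hB (mem_powerset.1 (mem_filter.1 hA).1 ha)]
    · obtain ⟨q, hq⟩ := hne
      obtain ⟨y, hy, -⟩ := (mem_filter.1 hA).2.2 q hq
      exact ⟨y, hy⟩
  have h1 := two_pow_add_card_cutsets hQ hU'
  have h2 := sum_two_pow_pCard_core hQ hU hB hne
  rw [antichainSum_eq hQ hU' (hne.mono hQ), hs]
  omega

end CoreSum

section Chain

variable (hc : ∀ x ∈ S, ∀ y ∈ S, Comparable x y)
include hc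

theorem basicIn_chain : BasicIn S x ↔ x ∈ S ∧ ∀ y ∈ S, x ≤ y := by
  constructor
  · rintro ⟨hx, -, -, h⟩
    refine ⟨hx, fun y hy => ?_⟩
    by_contra hxy
    have hyx : y < x := lt_of_le_not_ge ((hc x hx y hy).resolve_left hxy) hxy
    obtain ⟨u, hu⟩ := ({z ∈ S | z < x} : Finset α).exists_maximal ⟨y, mem_filter.2 ⟨hy, hyx⟩⟩
    obtain ⟨huS, hux⟩ := mem_filter.1 hu.1
    obtain ⟨w, hw, hwu, hwx, hn⟩ := h u huS hux
    rcases hc w hw x hx with h1 | h1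
    · have h2 : w ≤ u := by
        rcases hc w hw u huS with h | h
        · exact h
        · exact hu.2 (mem_filter.2 ⟨hw, lt_of_le_of_ne h1 hwx⟩) h
      exact hn ⟨iff_of_true h2 h1, iff_of_false (fun h => hwu (h2.antisymm h))
        fun h => hwx (h1.antisymm h)⟩
    · have h2 : u < w := hux.trans_le h1
      exact hn ⟨iff_of_false h2.not_ge fun h => hwx (h.antisymm h1), iff_of_true h2.le h1⟩
  · rintro ⟨hx, h⟩
    exact ⟨hx, fun u hu v hv _ _ => hc u hu v hv, fun u hu v hv _ _ => hc u hu v hv,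
      fun u hu hux => absurd hux (h u hu).not_gt⟩

theorem exists_basicIn_chain (hne : S.Nonempty) : ∃ x, BasicIn S x := by
  obtain ⟨m, hm⟩ := S.exists_minimal hne
  refine ⟨m, (basicIn_chain hc).2 ⟨hm.1, fun y hy => ?_⟩⟩
  exact (hc m hm.1 y hy).elim id fun h => hm.2 hy h

theorem pCard_chain (ha : a ∈ S) : pCard S a = #{b ∈ S | b < a} := by
  unfold pCard
  congr 1
  refine filter_congr fun b hb => ?_
  obtain ⟨m, hm⟩ := exists_basicIn_chain hc ⟨a, ha⟩
  have hm' := (basicIn_chain hc).1 hm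
  have hnl : ∀ x ∈ S, ¬LowerIn S x := by
    rintro x hx ⟨-, y, hy, hxy⟩
    exact (((basicIn_chain hc).1 hy).2 x hx).not_gt hxy
  constructor
  · rintro ⟨-, -, h | h⟩
    · exact absurd h.1 (hnl a ha)
    · exact h.2.2.1.1
  · intro h
    have hna : ¬BasicIn S a := fun h' => (((basicIn_chain hc).1 h').2 b hb).not_gt h
    exact ⟨hb, hna, Or.inr ⟨hnl a ha, ⟨hna, m, hm, (hm'.2 b hb).trans_lt h⟩,
      ⟨h, fun c hcS _ => hc a ha c hcS⟩, fun h' => hnl b hb h'.1⟩⟩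

theorem antichainSum_chain (hne : S.Nonempty) : antichainSum S = #(cutsets S) := by
  have hU : ∀ u ∈ S, u ∉ (∅ : Finset α) → ∀ x ∈ S, Comparable u x := fun u hu _ => hc u hu
  have h1 := two_pow_add_card_cutsets (empty_subset S) hU
  have h2 := sum_two_pow_card_lt 0 S hc
  have h3 : #(cutsets (∅ : Finset α)) = 0 := by
    rw [card_eq_zero, eq_empty_iff_forall_notMem]
    intro s hs
    obtain ⟨x, -, hx⟩ := (mem_filter.1 hs).2 ∅ ⟨subset_rfl, by simp, by simp⟩
    exact notMem_empty x hx
  have h4 : ∑ A ∈ maxAntichains (∅ : Finset α) with A.Nonempty, 2 ^ ∑ a ∈ A, pCard S a = 0 := by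
    refine sum_eq_zero fun A hA => ?_
    obtain ⟨hA, x, hx⟩ := mem_filter.1 hA
    exact absurd (mem_powerset.1 (mem_filter.1 hA).1 hx) (notMem_empty x)
  rw [antichainSum_eq (empty_subset S) hU hne, h4, sdiff_empty,
    sum_congr rfl fun u hu => by rw [pCard_chain hc hu]]
  simp only [zero_add, card_empty, pow_zero] at h1 h2
  omega

end Chain

/-- `S` has an element related to all of `S`, or splits into two nonempty unrelated parts. -/
def UniversalOrSplit {β : Type} (r : β → β → Prop) (S : Set β) : Prop :=
  (∃ u ∈ S, ∀ x ∈ S, r u x ∨ r x u) ∨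
  ∃ p : Set β, (∃ x ∈ S, x ∈ p) ∧ (∃ x ∈ S, x ∉ p) ∧
    ∀ x ∈ S, ∀ y ∈ S, x ∈ p → y ∉ p → ¬(r x y ∨ r y x)

theorem UniversalOrSplit.of_preimage {β γ : Type} {r : β → β → Prop} {s : γ → γ → Prop}
    {f : β → γ} (hf : f.Injective) (hrs : ∀ a b, r a b ↔ s (f a) (f b)) {S : Set γ}
    (hS : ∀ y ∈ S, ∃ x, f x = y) (h : UniversalOrSplit r (f ⁻¹' S)) :
    UniversalOrSplit s S := by
  rcases h with ⟨u, hu, h⟩ | ⟨p, ⟨x, hx, hxp⟩, ⟨y, hy, hyp⟩, h⟩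
  · refine Or.inl ⟨f u, hu, fun y hy => ?_⟩
    obtain ⟨x, rfl⟩ := hS y hy
    rw [← hrs, ← hrs]
    exact h x hy
  · refine Or.inr ⟨f '' p, ⟨f x, hx, x, hxp, rfl⟩, ⟨f y, hy, ?_⟩, ?_⟩
    · rwa [hf.mem_set_image]
    · intro a ha b hb hap hbp
      obtain ⟨a, rfl⟩ := hS a ha
      obtain ⟨b, rfl⟩ := hS b hb
      rw [hf.mem_set_image] at hap hbp
      rw [← hrs, ← hrs]
      exact h a ha b hb hap hbp

theorem UniversalOrSplit.option {β : Type} {r : β → β → Prop} {s : Option β → Option β → Prop}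
    (hrs : ∀ a b, r a b ↔ s (some a) (some b)) (hn : ∀ x, s none x ∨ s x none)
    (h : ∀ S : Set β, S.Nonempty → UniversalOrSplit r S) (S : Set (Option β))
    (hS : S.Nonempty) : UniversalOrSplit s S := by
  by_cases hnS : none ∈ S
  · exact Or.inl ⟨none, hnS, fun x _ => hn x⟩
  · have hsome : ∀ y ∈ S, ∃ x, some x = y := fun y hy => by
      cases y with
      | none => exact absurd hy hnS
      | some x => exact ⟨x, rfl⟩
    obtain ⟨y, hy⟩ := hS
    obtain ⟨x, rfl⟩ := hsome y hy
    exact .of_preimage (Option.some_injective β) hrs hsome (h _ ⟨x, hy⟩)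

theorem IsVRel.universalOrSplit {β : Type} {r : β → β → Prop} (h : IsVRel β r) :
    ∀ S : Set β, S.Nonempty → UniversalOrSplit r S := by
  induction h with
  | empty β r h => exact fun S ⟨x, _⟩ => h.elim x
  | @union β γ r s _ _ ih₁ ih₂ =>
    intro S ⟨x, hx⟩
    by_cases h₁ : ∃ a, Sum.inl a ∈ S
    · by_cases h₂ : ∃ b, Sum.inr b ∈ S
      · obtain ⟨a, ha⟩ := h₁
        obtain ⟨b, hb⟩ := h₂
        refine Or.inr ⟨Set.range Sum.inl, ⟨_, ha, a, rfl⟩, ⟨_, hb, by simp⟩, ?_⟩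
        rintro _ - (y | y) - ⟨z, rfl⟩ hy
        · exact absurd ⟨y, rfl⟩ hy
        · simp [sumRel]
      · refine .of_preimage Sum.inl_injective (s := sumRel r s) (fun _ _ => Iff.rfl) ?_
          (ih₁ _ h₁)
        rintro (y | y) hy
        · exact ⟨y, rfl⟩
        · exact absurd ⟨y, hy⟩ h₂
    · have hr : ∀ y ∈ S, ∃ z, Sum.inr z = y := by
        rintro (y | y) hy
        · exact absurd ⟨y, hy⟩ h₁
        · exact ⟨y, rfl⟩
      obtain ⟨z, rfl⟩ := hr x hx
      exact .of_preimage Sum.inr_injective (s := sumRel r s) (fun _ _ => Iff.rfl) hr (ih₂ _ ⟨z, hx⟩)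
  | addTop _ ih =>
    exact UniversalOrSplit.option (fun _ _ => Iff.rfl) (fun x => Or.inr (by simp [addTopRel])) ih
  | addBot _ ih =>
    exact UniversalOrSplit.option (fun _ _ => Iff.rfl) (fun x => Or.inl (by simp [addBotRel])) ih
  | congr e he _ ih =>
    intro S ⟨x, hx⟩
    exact .of_preimage e.injective he (fun y _ => e.surjective y)
      (ih _ ⟨e.symm x, by simpa using hx⟩)

theorem exists_basicIn_and_antichainSum_eq
    (h : ∀ S : Finset α, S.Nonempty → UniversalOrSplit (· ≤ ·) (S : Set α))
    (S : Finset α) (hne : S.Nonempty) :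
    (∃ x, BasicIn S x) ∧ antichainSum S = #(cutsets S) := by
  induction S using Finset.strongInduction with
  | H S ih =>
    set Q : Finset α := {x ∈ S | ∃ y ∈ S, ¬Comparable x y} with hQdef
    have mQ : ∀ x, x ∈ Q ↔ x ∈ S ∧ ∃ y ∈ S, ¬Comparable x y := fun x => by
      rw [hQdef, mem_filter]
    have hQ : Q ⊆ S := filter_subset _ _
    have hU : ∀ u ∈ S, u ∉ Q → ∀ x ∈ S, Comparable u x := fun u hu huQ x hx => by
      by_contra hux
      exact huQ ((mQ u).2 ⟨hu, x, hx, hux⟩)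
    rcases Q.eq_empty_or_nonempty with hQe | hQne
    · have hc : ∀ x ∈ S, ∀ y ∈ S, Comparable x y :=
        fun x hx => hU x hx (by rw [hQe]; exact notMem_empty x)
      exact ⟨exists_basicIn_chain hc hne, antichainSum_chain hc hne⟩
    obtain ⟨p, ⟨t, ht, htp⟩, ⟨t', ht', htp'⟩, hp⟩ := (h Q hQne).resolve_left (by
      rintro ⟨u, hu, hu'⟩
      obtain ⟨huS, y, hy, huy⟩ := (mQ u).1 hu
      exact huy (hu' y ((mQ y).2 ⟨hy, u, huS, fun h => huy h.symm⟩)))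
    set T : Finset α := {x ∈ Q | x ∈ p} with hT
    set T' : Finset α := {x ∈ Q | x ∉ p} with hT'
    have hTT : T ∪ T' = Q := filter_union_filter_not_eq _ _
    have hn : ∀ x ∈ T, ∀ y ∈ T', ¬Comparable x y := fun x hx y hy =>
      hp x (mem_filter.1 hx).1 y (mem_filter.1 hy).1 (mem_filter.1 hx).2 (mem_filter.1 hy).2
    have hTne : T.Nonempty := ⟨t, mem_filter.2 ⟨ht, htp⟩⟩
    have hTne' : T'.Nonempty := ⟨t', mem_filter.2 ⟨ht', htp'⟩⟩
    have hTS : T ⊂ S := ((filter_subset _ _).trans hQ).ssubset_of_ne fun h =>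
      htp' (mem_filter.1 (show t' ∈ T by rw [hT, h]; exact hQ ht')).2
    have hTS' : T' ⊂ S := ((filter_subset _ _).trans hQ).ssubset_of_ne fun h =>
      (mem_filter.1 (show t ∈ T' by rw [hT', h]; exact hQ ht)).2 htp
    obtain ⟨⟨b, hb⟩, hsum⟩ := ih T hTS hTne
    obtain ⟨⟨b', hb'⟩, hsum'⟩ := ih T' hTS' hTne'
    have hbQ : BasicIn Q b := by
      rw [← hTT]
      exact (basicIn_component subset_union_left
        (fun x hx y hy => mem_left_of_comparable hn y hx hy) hb.1).2 hb
    have hbQ' : BasicIn Q b' := by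
      rw [← hTT]
      exact (basicIn_component subset_union_right
        (fun x hx y hy => mem_right_of_comparable hn y hx hy) hb'.1).2 hb'
    have hB : ∀ x ∈ Q, ∃ y, BasicIn Q y ∧ ¬Comparable x y := fun x hx => by
      rw [← hTT] at hx
      rcases mem_union.1 hx with hx | hx
      · exact ⟨b', hbQ', hn x hx b' hb'.1⟩
      · exact ⟨b, hbQ, fun h => hn b hb.1 x hx h.symm⟩
    have hQsum : antichainSum Q = #(cutsets Q) := by
      rw [← hTT, antichainSum_union hn, card_cutsets_union hn hTne hTne', hsum, hsum']
    have hUQ : ∀ u ∈ S, u ∉ Q → (∀ x ∈ S, Comparable u x) ∧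
        ((∀ x ∈ Q, u < x) ∨ ∀ x ∈ Q, x < u) := fun u hu huQ => by
      refine ⟨hU u hu huQ, ?_⟩
      have hlt : ∀ x ∈ Q, u < x ∨ x < u := fun x hx => by
        have hne : u ≠ x := fun h => huQ (h ▸ hx)
        exact (hU u hu huQ x (hQ hx)).imp (fun h => lt_of_le_of_ne h hne)
          fun h => lt_of_le_of_ne h hne.symm
      have hside : ∀ x ∈ T, ∀ y ∈ T', (u < x ↔ u < y) := fun x hx y hy => by
        rcases hlt x (mem_filter.1 hx).1 with h | h <;>
          rcases hlt y (mem_filter.1 hy).1 with h' | h'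
        · exact iff_of_true h h'
        · exact absurd (Or.inr (h'.trans h).le) (hn x hx y hy)
        · exact absurd (Or.inl (h.trans h').le) (hn x hx y hy)
        · exact iff_of_false h.asymm h'.asymm
      have hall : ∀ x ∈ Q, (u < x ↔ u < b) := fun x hx => by
        rw [← hTT] at hx
        rcases mem_union.1 hx with hx | hx
        · rw [hside x hx b' hb'.1, hside b hb.1 b' hb'.1]
        · rw [hside b hb.1 x hx]
      by_cases hub : u < b
      · exact Or.inl fun x hx => (hall x hx).2 hub
      · exact Or.inr fun x hx => (hlt x hx).resolve_left fun h => hub ((hall x hx).1 h)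
    exact ⟨⟨b, (basicIn_core hQ hUQ hB hQne).2 hbQ⟩,
      antichainSum_eq_card_cutsets_of_core hQ hUQ hB hQne hQsum⟩

theorem setOf_eq_image_coe {β : Type*} [Finite β] {q : Set β → Prop} {F : Finset (Finset β)}
    (h : ∀ A : Finset β, q A ↔ A ∈ F) :
    {A : Set β | q A} = (fun A : Finset β => (A : Set β)) '' (F : Set (Finset β)) := by
  ext A
  obtain ⟨A, rfl⟩ := A.toFinite.exists_finset_coe
  simp [h]

section Univ

variable [Fintype α]

theorem isBasic_iff : IsBasic a ↔ BasicIn univ a := by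
  simp only [IsBasic, BasicIn, Incomp, Comparable, mem_univ, true_and, true_imp_iff]
  refine and_congr ?_ (and_congr ?_ ?_)
  · push Not
    exact ⟨fun h u v h1 h2 => by_contra fun h3 => h u v (by tauto) h1 h2,
      fun h u v h1 h2 h3 => (h u v h2 h3).elim h1.1 h1.2⟩
  · push Not
    exact ⟨fun h u v h1 h2 => by_contra fun h3 => h u v (by tauto) h1 h2,
      fun h u v h1 h2 h3 => (h u v h2 h3).elim h1.1 h1.2⟩
  · simp only [not_exists, not_and, not_forall, exists_prop]

theorem isLowerElt_iff : IsLowerElt a ↔ LowerIn univ a := by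
  simp only [IsLowerElt, LowerIn, isBasic_iff]

theorem isUpperElt_iff : IsUpperElt a ↔ UpperIn univ a := by
  simp only [IsUpperElt, UpperIn, isBasic_iff]

theorem basicAssoc_eq_iff : basicAssoc a = basicAssoc b ↔ AssocEq univ a b := by
  simp only [basicAssoc, AssocEq, Set.ext_iff, Set.mem_ofPred_eq, isBasic_iff, and_congr_right_iff,
    Comparable]

theorem mem_pSet_iff : b ∈ pSet a ↔ MemPSet univ a b := by
  have hi : ∀ q : α → Prop, (¬∃ c, Incomp a c ∧ q c) ↔ ∀ c, q c → Comparable a c := fun q => by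
    simp only [Incomp, Comparable, not_exists, not_and, not_imp_not]
  unfold pSet
  simp only [isBasic_iff, isLowerElt_iff, isUpperElt_iff, basicAssoc_eq_iff, hi, MemPSet, mem_univ,
    true_and, true_imp_iff]
  split_ifs <;> simp [*]

theorem ncard_pSet : (pSet a).ncard = pCard univ a := by
  rw [pCard, ← Set.ncard_coe_finset]
  congr 1
  ext b
  simp [mem_pSet_iff]

theorem isMaxAntichainSet_coe_iff (A : Finset α) :
    IsMaxAntichainSet (A : Set α) ↔ A ∈ maxAntichains univ := by
  simp only [maxAntichains, mem_filter, mem_powerset, subset_univ, true_and, mem_univ,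
    true_imp_iff]
  constructor
  · rintro ⟨h1, h2⟩
    have h3 : ∀ x ∈ A, ∀ y ∈ A, Comparable x y → x = y := fun x hx y hy h =>
      h.elim (fun h => h1.eq hx hy h) fun h => (h1.eq hy hx h).symm
    refine ⟨h3, fun x => ?_⟩
    by_contra! hn
    have hx : x ∈ (A : Set α) := by
      rw [h2 (insert x (A : Set α)) ?_ (Set.subset_insert _ _)]
      · exact Set.mem_insert _ _
      · exact h1.insert (fun y hy _ h => hn y hy (Or.inr h)) fun y hy _ h => hn y hy (Or.inl h)
    exact hn x hx (comparable_refl x)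
  · rintro ⟨h1, h2⟩
    refine ⟨fun x hx y hy hne h => hne (h1 x hx y hy (Or.inl h)), fun t ht hAt => ?_⟩
    refine hAt.antisymm fun x hx => ?_
    obtain ⟨y, hy, hxy⟩ := h2 x
    have : x = y := hxy.elim (fun h => ht.eq hx (hAt hy) h) fun h => (ht.eq (hAt hy) hx h).symm
    exact this ▸ hy

theorem isMaxChain_coe_iff (c : Finset α) :
    IsMaxChain (· ≤ ·) (c : Set α) ↔ IsMaxChainIn univ c := by
  simp only [IsMaxChainIn, subset_univ, true_and, mem_univ, true_imp_iff]
  constructor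
  · rintro ⟨h1, h2⟩
    refine ⟨fun x hx y hy => h1.total hx hy, fun x hx => ?_⟩
    have := h2 (h1.insert fun y hy _ => hx y hy) (Set.subset_insert x _)
    exact mem_coe.1 (this ▸ Set.mem_insert x _)
  · rintro ⟨h1, h2⟩
    refine ⟨fun x hx y hy _ => h1 x hx y hy, fun t ht hct => ?_⟩
    exact hct.antisymm fun x hx => h2 x fun y hy => ht.total hx (hct hy)

theorem isCutset_coe_iff (s : Finset α) : IsCutset (s : Set α) ↔ s ∈ cutsets univ := by
  simp only [cutsets, mem_filter, mem_powerset, subset_univ, true_and, IsCutset]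
  constructor
  · intro h c hc
    obtain ⟨x, hx, hxc⟩ := h c ((isMaxChain_coe_iff c).2 hc)
    exact ⟨x, hx, hxc⟩
  · intro h c hc
    obtain ⟨c, rfl⟩ := c.toFinite.exists_finset_coe
    obtain ⟨x, hx, hxc⟩ := h c ((isMaxChain_coe_iff c).1 hc)
    exact ⟨x, hx, hxc⟩

theorem finsum_maxAntichain_eq :
    ∑ᶠ A ∈ {A : Set α | IsMaxAntichainSet A}, 2 ^ (∑ᶠ a ∈ A, (pSet a).ncard)
      = antichainSum (univ : Finset α) := by
  rw [setOf_eq_image_coe isMaxAntichainSet_coe_iff, finsum_mem_image coe_injective.injOn,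
    finsum_mem_coe_finset, antichainSum]
  refine sum_congr rfl fun A _ => ?_
  rw [finsum_mem_coe_finset, sum_congr rfl fun a _ => ncard_pSet]

theorem ncard_cutsets : {s : Set α | IsCutset s}.ncard = #(cutsets (univ : Finset α)) := by
  rw [setOf_eq_image_coe isCutset_coe_iff, Set.ncard_image_of_injective _ coe_injective,
    Set.ncard_coe_finset]

end Univ

end Relative

/-- For every nonempty (finite) `𝒱`-poset `P`, the sum of
`2^{s(A)}` over all maximal antichains `A` of `P` — where `s(A) = Σ_{a ∈ A} |P_a|`
— equals the number of cutsets of `P`. -/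
theorem sum_two_pow_s_eq_card_cutsets (α : Type) [PartialOrder α]
    [Fintype α] [Nonempty α] (h : IsVPoset α) :
    ∑ᶠ A ∈ {A : Set α | IsMaxAntichainSet A}, 2 ^ (∑ᶠ a ∈ A, (pSet a).ncard)
      = {s : Set α | IsCutset s}.ncard := by
  rw [finsum_maxAntichain_eq, ncard_cutsets]
  exact (exists_basicIn_and_antichainSum_eq
    (fun S hS => h.universalOrSplit S (Finset.coe_nonempty.2 hS)) Finset.univ Finset.univ_nonempty).2
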